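/- Let Ω ⊆ ℝⁿ be open and f : Ω → ℝᵈ continuous. If for some gauge function φ there is a set N ⊆ Ω with H^φ(N) = 0 and H^n(f(N)) > 0, then there exists a compact, perfect, totally disconnected set K ⊆ Ω with H^φ(K) = 0 and H^n(f(K)) > 0. -/

import Mathlib

open MeasureTheory Metric

/-- A gauge function: nondecreasing, right-continuous, positive for positive arguments. -/
def IsGauge (φ : ℝ → ℝ) : Prop :=
  Monotone φ ∧ (∀ t : ℝ, 0 < t → 0 < φ t) ∧
    ∀ t : ℝ, 0 ≤ t → ContinuousWithinAt φ (Set.Ici t) t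

/-- The Hausdorff measure associated with the gauge `φ`. -/
noncomputable def hausdorffGauge {X : Type*} [EMetricSpace X] [MeasurableSpace X]
    [BorelSpace X] (φ : ℝ → ℝ) : Measure X :=
  Measure.mkMetric (fun d => ENNReal.ofReal (φ d.toReal))

open scoped ENNReal Topology

def netCov {X Y : Type*} (π : ℕ → X → Y) (S : Set (ℕ × Y)) : Set X := {x | ∃ k, (k, π k x) ∈ S}

noncomputable def netM {X Y : Type*} [MeasurableSpace (ℕ × Y)] (π : ℕ → X → Y)
    (W : Measure (ℕ × Y)) (E : Set X) : ℝ≥0∞ :=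
  ⨅ S : Set (ℕ × Y), ⨅ (_ : E ⊆ netCov π S), W S

lemma netM_le {X Y : Type*} [MeasurableSpace (ℕ × Y)] {π : ℕ → X → Y}
    {W : Measure (ℕ × Y)} {E : Set X} {S : Set (ℕ × Y)} (h : E ⊆ netCov π S) :
    netM π W E ≤ W S := iInf₂_le S h

lemma netM_mono {X Y : Type*} [MeasurableSpace (ℕ × Y)] {π : ℕ → X → Y}
    {W : Measure (ℕ × Y)} {E F : Set X} (h : E ⊆ F) :
    netM π W E ≤ netM π W F := le_iInf₂ fun _ hS => netM_le (h.trans hS)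

lemma netM_exists {X Y : Type*} [MeasurableSpace (ℕ × Y)] {π : ℕ → X → Y}
    {W : Measure (ℕ × Y)} {E : Set X} {c : ℝ≥0∞} (h : netM π W E < c) :
    ∃ S, E ⊆ netCov π S ∧ W S < c := by
  obtain ⟨S, hS⟩ := iInf_lt_iff.1 h
  obtain ⟨h1, h2⟩ := iInf_lt_iff.1 hS
  exact ⟨S, h1, h2⟩

/-- Increasing sets lemma for net contents. -/
lemma netM_iUnion_le {X Y : Type*} [MeasurableSpace (ℕ × Y)] [DiscreteMeasurableSpace (ℕ × Y)]
    {π : ℕ → X → Y} (hπ : ∀ k l, l ≤ k → ∀ x y, π k x = π k y → π l x = π l y)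
    {W : Measure (ℕ × Y)} {E : ℕ → Set X} (hE : Monotone E) {c : ℝ≥0∞} (hc : c ≠ ∞)
    (h : ∀ i, netM π W (E i) ≤ c) : netM π W (⋃ i, E i) ≤ c := by
  refine ENNReal.le_of_forall_pos_le_add fun ε hε _ => ?_
  have hε2 : (ε : ℝ≥0∞) / 2 ≠ 0 := by simp [hε.ne']
  obtain ⟨e, he0, hesum⟩ := ENNReal.exists_pos_sum_of_countable' hε2 ℕ
  have hfin : ∀ i, netM π W (E i) ≠ ∞ := fun i => ((h i).trans_lt hc.lt_top).ne
  have hex : ∀ i, ∃ S, E i ⊆ netCov π S ∧ W S < netM π W (E i) + e i := fun i =>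
    netM_exists (ENNReal.lt_add_right (hfin i) (he0 i).ne')
  choose Q hQc hQW using hex
  have hele : ∀ i, e i ≤ ε / 2 := fun i => (ENNReal.le_tsum i).trans hesum.le
  have hQfin : ∀ i, W (Q i) ≠ ∞ := fun i => (hQW i).ne_top
  set T : Set (ℕ × Y) := ⋃ i, Q i with hT
  set R : Set (ℕ × Y) := {q | q ∈ T ∧ ∀ x, π q.1 x = q.2 → ∀ l < q.1, (l, π l x) ∉ T} with hR
  set F : ℕ → Set (ℕ × Y) := fun i => {r | r ∈ R ∧ r ∈ Q i ∧ ∀ j < i, r ∉ Q j} with hF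
  have hRcov : (⋃ i, E i) ⊆ netCov π R := by
    classical
    intro x hx
    obtain ⟨i, hi⟩ := Set.mem_iUnion.1 hx
    have hk : ∃ k, (k, π k x) ∈ T := by
      obtain ⟨k, hk⟩ := hQc i hi
      exact ⟨k, Set.mem_iUnion.2 ⟨i, hk⟩⟩
    refine ⟨Nat.find hk, Nat.find_spec hk, ?_⟩
    intro y hy l hl hT'
    have : π l y = π l x := hπ _ _ (le_of_lt hl) _ _ hy
    rw [this] at hT'
    exact Nat.find_min hk hl hT'
  have hRF : R ⊆ ⋃ p : ℕ, ⋃ i ∈ Finset.range (p + 1), F i := by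
    classical
    intro r hr
    have hk : ∃ i, r ∈ Q i := Set.mem_iUnion.1 hr.1
    refine Set.mem_iUnion.2 ⟨Nat.find hk, Set.mem_iUnion₂.2 ⟨Nat.find hk, by simp, hr,
      Nat.find_spec hk, fun j hj => Nat.find_min hk hj⟩⟩
  have key : ∀ p : ℕ, W (⋃ i ∈ Finset.range (p + 1), F i) ≤ c + ε := by
    intro p
    set B : ℕ → Set (ℕ × Y) := fun i =>
      {q | q ∈ Q p ∧ ∃ x, π q.1 x = q.2 ∧ ∃ l ≤ q.1, (l, π l x) ∈ F i} with hB
    have hdisj : ∀ i j, i ≠ j → Disjoint (B i) (B j) := by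
      intro i j hij
      rw [Set.disjoint_left]
      rintro q ⟨-, x, hx, l, hl, hxl⟩ ⟨-, y, hy, m, hm, hym⟩
      have h1 : π l x = π l y := hπ _ _ hl _ _ (hx.trans hy.symm)
      rw [h1] at hxl
      have hlm : l = m := by
        rcases lt_trichotomy l m with h | h | h
        · exact absurd hxl.1.1 (hym.1.2 y rfl l h)
        · exact h
        · exact absurd hym.1.1 (hxl.1.2 y rfl m h)
      subst hlm
      rcases lt_or_gt_of_ne hij with h | h
      · exact hym.2.2 i h hxl.2.1
      · exact hxl.2.2 j h hym.2.1
    have hFB : ∀ i ≤ p, W (F i) ≤ W (B i) + e i := by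
      intro i hi
      have hcov : E i ⊆ netCov π (B i ∪ (Q i \ F i)) := by
        intro x hx
        obtain ⟨k, hk⟩ := hQc i hx
        by_cases hkF : (k, π k x) ∈ F i
        · obtain ⟨m, hm⟩ := hQc p (hE hi hx)
          refine ⟨m, Or.inl ⟨hm, x, rfl, k, ?_, hkF⟩⟩
          by_contra hlt
          exact hkF.1.2 x rfl m (not_le.1 hlt) (Set.mem_iUnion.2 ⟨p, hm⟩)
        · exact ⟨k, Or.inr ⟨hk, hkF⟩⟩
      have hFQ : F i ⊆ Q i := fun r hr => hr.2.1
      have h1 : W (F i) + W (Q i \ F i) = W (Q i) := by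
        rw [add_comm]
        have h3 := measure_sdiff_add_inter (μ := W) (Q i) (MeasurableSet.of_discrete (s := F i))
        rwa [Set.inter_eq_self_of_subset_right hFQ] at h3
      have h2 : W (F i) + W (Q i \ F i) ≤ (W (B i) + e i) + W (Q i \ F i) := by
        calc W (F i) + W (Q i \ F i) = W (Q i) := h1
          _ ≤ netM π W (E i) + e i := (hQW i).le
          _ ≤ (W (B i) + W (Q i \ F i)) + e i := by
              gcongr
              exact (netM_le hcov).trans (measure_union_le _ _)
          _ = _ := by ring
      exact ENNReal.le_of_add_le_add_right (measure_ne_top_of_subset Set.sdiff_subset (hQfin i)) h2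
    calc W (⋃ i ∈ Finset.range (p + 1), F i) ≤ ∑ i ∈ Finset.range (p + 1), W (F i) :=
          measure_biUnion_finset_le _ _
      _ ≤ ∑ i ∈ Finset.range (p + 1), (W (B i) + e i) :=
          Finset.sum_le_sum fun i hi => hFB i (by simp at hi; omega)
      _ = W (⋃ i ∈ Finset.range (p + 1), B i) + ∑ i ∈ Finset.range (p + 1), e i := by
          rw [Finset.sum_add_distrib, measure_biUnion_finset (fun i _ j _ hij => hdisj i j hij)
            (fun _ _ => MeasurableSet.of_discrete)]
      _ ≤ W (Q p) + ε / 2 := by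
          gcongr
          · exact Set.iUnion₂_subset fun i _ q hq => hq.1
          · exact (ENNReal.sum_le_tsum _).trans hesum.le
      _ ≤ (c + ε / 2) + ε / 2 := by
          gcongr
          exact (hQW p).le.trans (add_le_add (h p) (hele p))
      _ = c + ε := by rw [add_assoc, ENNReal.add_halves]
  refine (netM_le (hRcov.trans (fun x ⟨k, hk⟩ => ⟨k, hRF hk⟩))).trans ?_
  rw [Monotone.measure_iUnion]
  · exact iSup_le key
  · intro a b hab
    exact Set.biUnion_subset_biUnion_left (by
      intro i hi; simp at hi ⊢; omega)

lemma mkMetric_cover {X : Type*} [EMetricSpace X] [MeasurableSpace X] [BorelSpace X]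
    {m : ℝ≥0∞ → ℝ≥0∞} {N : Set X} (hN : Measure.mkMetric m N = 0) {r ε : ℝ≥0∞} (hr : 0 < r)
    (hε : 0 < ε) : ∃ t : ℕ → Set X, N ⊆ ⋃ j, t j ∧ (∀ j, ediam (t j) ≤ r) ∧
      ∑' j, (⨆ _ : (t j).Nonempty, m (ediam (t j))) < ε := by
  rw [Measure.mkMetric_apply] at hN
  have h1 : (⨅ (t : ℕ → Set X) (_ : N ⊆ Set.iUnion t) (_ : ∀ n, ediam (t n) ≤ r),
          ∑' n, ⨆ _ : (t n).Nonempty, m (ediam (t n))) < ε := by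
    refine lt_of_le_of_lt ?_ hε
    rw [← hN]
    exact le_iSup₂ (f := fun (r : ℝ≥0∞) (_ : 0 < r) =>
      (⨅ (t : ℕ → Set X) (_ : N ⊆ Set.iUnion t) (_ : ∀ n, ediam (t n) ≤ r),
          ∑' n, ⨆ _ : (t n).Nonempty, m (ediam (t n)))) r hr
  obtain ⟨t, h1⟩ := iInf_lt_iff.1 h1
  obtain ⟨h2, h1⟩ := iInf_lt_iff.1 h1
  obtain ⟨h3, h1⟩ := iInf_lt_iff.1 h1
  exact ⟨t, h2, h3, h1⟩

lemma mkMetric_gauge_zero {X : Type*} [EMetricSpace X] [MeasurableSpace X] [BorelSpace X]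
    {m : ℝ≥0∞ → ℝ≥0∞} (hmono : ∀ t, t ≠ ∞ → m 0 ≤ m t) {N : Set X}
    (hN : Measure.mkMetric m N = 0) (hne : N.Nonempty) : m 0 = 0 := by
  by_contra h
  obtain ⟨t, h1, h2, h3⟩ := mkMetric_cover hN one_pos (pos_iff_ne_zero.2 h)
  obtain ⟨x, hx⟩ := hne
  obtain ⟨j, hj⟩ := Set.mem_iUnion.1 (h1 hx)
  refine absurd h3 (not_lt.2 ?_)
  refine le_trans ?_ (ENNReal.le_tsum j)
  have : (t j).Nonempty := ⟨x, hj⟩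
  simp only [this, iSup_pos]
  exact hmono _ ((h2 j).trans_lt ENNReal.one_lt_top).ne

lemma mkMetric_open_cover {X : Type*} [EMetricSpace X] [MeasurableSpace X] [BorelSpace X]
    {m : ℝ≥0∞ → ℝ≥0∞} (hm : ∀ t, t ≠ ∞ → ContinuousWithinAt m (Set.Ici t) t) (hm0 : m 0 = 0)
    {N : Set X} (hN : Measure.mkMetric m N = 0) {r ε : ℝ≥0∞} (hr : 0 < r) (hr' : r ≠ ∞)
    (hε : 0 < ε) (hε' : ε ≠ ∞) : ∃ (V : ℕ → Set X) (ρ : ℕ → ℝ≥0∞), (∀ j, IsOpen (V j)) ∧ N ⊆ ⋃ j, V j ∧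
      (∀ j, ediam (V j) ≤ ρ j) ∧ (∀ j, 0 < ρ j) ∧ (∀ j, ρ j ≤ r) ∧ ∑' j, m (ρ j) ≤ ε := by
  have hr2 : r / 2 < r := ENNReal.half_lt_self hr.ne' hr'
  obtain ⟨t, h1, h2, h3⟩ := mkMetric_cover hN (ENNReal.half_pos hr.ne') (ENNReal.half_pos hε.ne')
  obtain ⟨e, he0, hes⟩ := ENNReal.exists_pos_sum_of_countable' (ENNReal.half_pos hε.ne').ne' ℕ
  have hterm : ∀ j, (⨆ _ : (t j).Nonempty, m (ediam (t j))) = m (ediam (t j)) := by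
    intro j
    rcases (t j).eq_empty_or_nonempty with h | h
    · simp [h, hm0]
    · simp [h]
  simp only [hterm] at h3
  have hfin : ∀ j, m (ediam (t j)) ≠ ∞ := fun j =>
    ((ENNReal.le_tsum j).trans_lt (h3.trans_le le_top)).ne
  have hρ : ∀ j, ∃ ρ, ediam (t j) < ρ ∧ ρ < r ∧ m ρ < m (ediam (t j)) + e j := by
    intro j
    have htj : ediam (t j) < r := (h2 j).trans_lt hr2
    have hne : ediam (t j) ≠ ∞ := (htj.trans_le le_top).ne
    have hc : Filter.Tendsto m (𝓝[>] ediam (t j)) (𝓝 (m (ediam (t j)))) :=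
      (hm _ hne).mono_left (nhdsWithin_mono _ Set.Ioi_subset_Ici_self)
    have e1 := hc.eventually_lt_const (ENNReal.lt_add_right (hfin j) (he0 j).ne')
    have e2 := Ioo_mem_nhdsGT htj
    have : (𝓝[>] ediam (t j)).NeBot := nhdsGT_neBot_of_exists_gt ⟨r, htj⟩
    obtain ⟨ρ, h, h'⟩ := (e1.and e2).exists
    exact ⟨ρ, h'.1, h'.2, h⟩
  choose ρ hρ1 hρ2 hρ3 using hρ
  have hδ : ∀ j, ∃ δ : NNReal, 0 < δ ∧ ediam (t j) + 2 * δ ≤ ρ j := by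
    intro j
    have hsub : ρ j - ediam (t j) ≠ ∞ := ENNReal.sub_ne_top ((hρ2 j).trans_le le_top).ne
    have hpos : 0 < ρ j - ediam (t j) := tsub_pos_of_lt (hρ1 j)
    have h2t : (ρ j - ediam (t j)) / 2 ≠ ∞ := ENNReal.div_ne_top hsub (by simp)
    refine ⟨((ρ j - ediam (t j)) / 2).toNNReal, ENNReal.toNNReal_pos
      (ENNReal.half_pos hpos.ne').ne' h2t, ?_⟩
    rw [ENNReal.coe_toNNReal h2t, ENNReal.mul_div_cancel (by simp) (by simp),
      add_tsub_cancel_of_le (hρ1 j).le]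
  choose δ hδ0 hδ using hδ
  refine ⟨fun j => thickening (δ j) (t j), ρ, fun j => isOpen_thickening, ?_, ?_, ?_, ?_, ?_⟩
  · exact h1.trans (Set.iUnion_mono fun j => self_subset_thickening (hδ0 j) _)
  · exact fun j => (ediam_thickening_le _).trans (hδ j)
  · exact fun j => (zero_le).trans_lt (hρ1 j)
  · exact fun j => (hρ2 j).le
  · calc ∑' j, m (ρ j) ≤ ∑' j, (m (ediam (t j)) + e j) := ENNReal.tsum_le_tsum fun j => (hρ3 j).le
      _ = ∑' j, m (ediam (t j)) + ∑' j, e j := ENNReal.tsum_add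
      _ ≤ ε / 2 + ε / 2 := add_le_add h3.le hes.le
      _ = ε := ENNReal.add_halves _

lemma mkMetric_Gdelta {X : Type*} [EMetricSpace X] [MeasurableSpace X] [BorelSpace X]
    {m : ℝ≥0∞ → ℝ≥0∞} (hm : ∀ t, t ≠ ∞ → ContinuousWithinAt m (Set.Ici t) t) (hm0 : m 0 = 0)
    (hmono : ∀ s t, t ≠ ∞ → s ≤ t → m s ≤ m t)
    {N : Set X} (hN : Measure.mkMetric m N = 0) :
    ∃ U : ℕ → Set X, (∀ k, IsOpen (U k)) ∧ (∀ k, N ⊆ U k) ∧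
      Measure.mkMetric m (⋂ k, U k) = 0 := by
  have hpos : ∀ k : ℕ, (0 : ℝ≥0∞) < ((k : ℝ≥0∞) + 1)⁻¹ := fun k => by
    simp
  have hfin : ∀ k : ℕ, ((k : ℝ≥0∞) + 1)⁻¹ ≠ ∞ := fun k => by simp
  choose V ρ h1 h2 h3 h4 h5 h6 using fun k : ℕ =>
    mkMetric_open_cover hm hm0 hN (hpos k) (hfin k) (hpos k) (hfin k)
  have hlim : Filter.Tendsto (fun k : ℕ => ((k : ℝ≥0∞) + 1)⁻¹) Filter.atTop (𝓝 0) := by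
    have := (Filter.tendsto_add_atTop_iff_nat 1).2 ENNReal.tendsto_inv_nat_nhds_zero
    simpa using this
  refine ⟨fun k => ⋃ j, V k j, fun k => isOpen_iUnion (h1 k), h2, ?_⟩
  refine le_antisymm ?_ (zero_le)
  calc Measure.mkMetric m (⋂ k, ⋃ j, V k j) 
      ≤ Filter.liminf (fun k => ∑' j, m (ediam (V k j))) Filter.atTop :=
        Measure.mkMetric_le_liminf_tsum _ _ hlim V
          (Filter.Eventually.of_forall fun k j => (h3 k j).trans (h5 k j))
          (Filter.Eventually.of_forall fun k => Set.iInter_subset _ k) m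
    _ ≤ Filter.liminf (fun k : ℕ => ((k : ℝ≥0∞) + 1)⁻¹) Filter.atTop := by
        refine Filter.liminf_le_liminf (Filter.Eventually.of_forall fun k => ?_)
        refine le_trans (ENNReal.tsum_le_tsum fun j => ?_) (h6 k)
        exact hmono _ _ ((h5 k j).trans_lt (hfin k).lt_top).ne (h3 k j)
    _ = 0 := hlim.liminf_eq

/-- The avoided coordinate sets. -/
def badSet (n α : ℕ) : Set (EuclideanSpace ℝ (Fin n)) :=
  {x | ∃ i, ∃ q : ℚ, x i = q + α * √2}

lemma exists_not_badSet {n : ℕ} (x : EuclideanSpace ℝ (Fin n)) : ∃ α, x ∉ badSet n α := by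
  by_contra! h
  choose i q hq using h
  obtain ⟨a, b, hab, hi⟩ := Finite.exists_ne_map_eq_of_infinite i
  have h1 := hq a
  have h2 := hq b
  rw [hi] at h1
  have hne : (a : ℚ) - b ≠ 0 := sub_ne_zero.2 (by exact_mod_cast hab)
  have hne' : (a : ℝ) - b ≠ 0 := by exact_mod_cast hne
  have h3 : √2 = (((q b - q a) / ((a : ℚ) - b) : ℚ) : ℝ) := by
    push_cast
    rw [eq_div_iff hne']
    linarith
  exact irrational_sqrt_two ⟨_, h3.symm⟩

lemma isTotallyDisconnected_of_badSet {n α : ℕ} {K : Set (EuclideanSpace ℝ (Fin n))}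
    (hK : ∀ x ∈ K, x ∉ badSet n α) : IsTotallyDisconnected K := by
  intro t htK ht x hx y hy
  ext i
  have hc : Continuous (fun z : EuclideanSpace ℝ (Fin n) => z i) := by fun_prop
  have hconn := (ht.image _ hc.continuousOn).ordConnected
  have aux : ∀ x ∈ t, ∀ y ∈ t, ¬ x i < y i := by
    intro x hx y hy hlt
    obtain ⟨q, hq1, hq2⟩ := exists_rat_btwn (sub_lt_sub_right hlt (α * √2))
    have : (q : ℝ) + α * √2 ∈ (fun z : EuclideanSpace ℝ (Fin n) => z i) '' t :=
      hconn.out ⟨x, hx, rfl⟩ ⟨y, hy, rfl⟩ ⟨by linarith, by linarith⟩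
    obtain ⟨z, hz, hzq⟩ := this
    exact hK z (htK hz) ⟨i, q, hzq⟩
  exact le_antisymm (not_lt.1 (aux y hy x hx)) (not_lt.1 (aux x hx y hy))

lemma badSet_compl {n α : ℕ} : ∃ O : ℕ → Set (EuclideanSpace ℝ (Fin n)),
    (∀ k, IsOpen (O k)) ∧ (badSet n α)ᶜ = ⋂ k, O k := by
  obtain ⟨e, he⟩ := exists_surjective_nat ℚ
  refine ⟨fun k => ⋂ i, {x | x i ≠ e k + α * √2}, fun k => ?_, ?_⟩
  · refine isOpen_iInter_of_finite fun i => ?_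
    exact isOpen_ne_fun (by fun_prop) (by fun_prop)
  · ext x
    simp only [badSet, Set.mem_compl_iff, Set.mem_ofPred_eq, Set.mem_iInter, not_exists, ne_eq]
    constructor
    · intro h k i; exact h i _
    · intro h i q
      obtain ⟨k, rfl⟩ := he q
      exact h k i

/-- exhaustion of an open set by compact sets -/
lemma exists_compact_exhaustion {n : ℕ} {U : Set (EuclideanSpace ℝ (Fin n))} (hU : IsOpen U) :
    ∃ C : ℕ → Set (EuclideanSpace ℝ (Fin n)), (∀ j, IsCompact (C j)) ∧ Monotone C ∧
      ⋃ j, C j = U := by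
  obtain ⟨F, hF, -, hFU, hFm⟩ := hU.exists_iUnion_isClosed
  refine ⟨fun j => F j ∩ closedBall 0 j, fun j => (isCompact_closedBall 0 _).inter_left (hF j),
    fun a b hab => Set.inter_subset_inter (hFm hab) (closedBall_subset_closedBall (by exact_mod_cast hab)), ?_⟩
  rw [← hFU]
  apply subset_antisymm
  · exact Set.iUnion_mono fun j => Set.inter_subset_left
  · intro x hx
    obtain ⟨j, hj⟩ := Set.mem_iUnion.1 hx
    obtain ⟨k, hk⟩ := exists_nat_ge ‖x‖
    refine Set.mem_iUnion.2 ⟨max j k, hFm (le_max_left _ _) hj, ?_⟩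
    rw [mem_closedBall_zero_iff]
    exact hk.trans (by exact_mod_cast le_max_right _ _)

/-- Choose compacts in each open set keeping a monotone increasing-continuous set function large. -/
lemma exists_compact_of_capacity {n : ℕ} {U : ℕ → Set (EuclideanSpace ℝ (Fin n))}
    (hU : ∀ k, IsOpen (U k)) {N : Set (EuclideanSpace ℝ (Fin n))} (hN : ∀ k, N ⊆ U k)
    (cap : Set (EuclideanSpace ℝ (Fin n)) → ℝ≥0∞) {c : ℝ≥0∞}
    (hmono : ∀ A B, A ⊆ B → cap A ≤ cap B)
    (hcap : ∀ E : ℕ → Set (EuclideanSpace ℝ (Fin n)), Monotone E → c < cap (⋃ i, E i) →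
      ∃ i, c < cap (E i)) (hc : c < cap N) :
    ∃ K : ℕ → Set (EuclideanSpace ℝ (Fin n)), (∀ k, IsCompact (K k)) ∧ Antitone K ∧
      (∀ k, K k ⊆ U k) ∧ ∀ k, c < cap (K k) := by
  choose C hC1 hC2 hC3 using fun k => exists_compact_exhaustion (hU k)
  have step : ∀ (k : ℕ) (A : {A : Set (EuclideanSpace ℝ (Fin n)) // A ⊆ N ∧ c < cap A}),
      ∃ j, c < cap (A.1 ∩ C k j) := by
    intro k A
    refine hcap (fun j => A.1 ∩ C k j) (fun a b hab => Set.inter_subset_inter_right _ (hC2 k hab)) ?_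
    rw [← Set.inter_iUnion, hC3, Set.inter_eq_self_of_subset_left (A.2.1.trans (hN k))]
    exact A.2.2
  choose J hJ using step
  let A : ℕ → {A : Set (EuclideanSpace ℝ (Fin n)) // A ⊆ N ∧ c < cap A} := fun k =>
    Nat.rec ⟨N, subset_rfl, hc⟩
      (fun k A => ⟨A.1 ∩ C k (J k A), Set.inter_subset_left.trans A.2.1, hJ k A⟩) k
  have hA : ∀ k, (A (k + 1)).1 = (A k).1 ∩ C k (J k (A k)) := fun k => rfl
  refine ⟨fun k => ⋂ l ∈ Finset.range (k + 1), C l (J l (A l)), fun k => ?_, ?_, ?_, ?_⟩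
  · refine (hC1 k (J k (A k))).of_isClosed_subset ?_ ?_
    · exact isClosed_biInter fun l _ => (hC1 l _).isClosed
    · exact Set.biInter_subset_of_mem (by simp)
  · intro a b hab
    exact Set.biInter_subset_biInter_left (by intro i hi; simp at hi ⊢; omega)
  · intro k
    refine (Set.biInter_subset_of_mem (x := k) (by simp)).trans ?_
    rw [← hC3 k]
    exact Set.subset_iUnion (C k) _
  · intro k
    refine (A (k + 1)).2.2.trans_le (hmono _ _ ?_)
    have : ∀ k, ∀ l < k, (A k).1 ⊆ C l (J l (A l)) := by
      intro k
      induction k with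
      | zero => intro l hl; omega
      | succ k ih =>
        intro l hl
        rw [hA]
        rcases Nat.lt_succ_iff_lt_or_eq.1 hl with h | rfl
        · exact Set.inter_subset_left.trans (ih l h)
        · exact Set.inter_subset_right
    exact Set.subset_iInter₂ fun l hl => this _ l (Finset.mem_range.1 hl)

/-- Dyadic address at level `k`. -/
noncomputable def dyad (d : ℕ) (k : ℕ) (x : EuclideanSpace ℝ (Fin d)) : Fin d → ℤ :=
  fun i => ⌊(2 : ℝ) ^ k * x i⌋

noncomputable def dyadW (d n : ℕ) : Measure (ℕ × (Fin d → ℤ)) :=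
  Measure.count.withDensity (fun p => ((2 : ℝ≥0∞)⁻¹ ^ p.1) ^ n)

lemma dyadW_apply (d n : ℕ) (S : Set (ℕ × (Fin d → ℤ))) :
    dyadW d n S = ∑' p, S.indicator (fun p => ((2 : ℝ≥0∞)⁻¹ ^ p.1) ^ n) p := by
  rw [dyadW, withDensity_apply _ MeasurableSet.of_discrete,
    ← lintegral_indicator MeasurableSet.of_discrete, lintegral_count]

lemma dyad_refine (d : ℕ) (k l : ℕ) (hlk : l ≤ k) (x y : EuclideanSpace ℝ (Fin d))
    (h : dyad d k x = dyad d k y) : dyad d l x = dyad d l y := by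
  funext i
  have hi : ⌊(2 : ℝ) ^ k * x i⌋ = ⌊(2 : ℝ) ^ k * y i⌋ := congrFun h i
  have aux : ∀ (a : ℤ) (t : ℝ), a ≤ ⌊(2 : ℝ) ^ l * t⌋ ↔ a * 2 ^ (k - l) ≤ ⌊(2 : ℝ) ^ k * t⌋ := by
    intro a t
    rw [Int.le_floor, Int.le_floor]
    have : (2 : ℝ) ^ k = 2 ^ l * 2 ^ (k - l) := by rw [← pow_add]; congr 1; omega
    rw [this]
    push_cast
    rw [show (2 : ℝ) ^ l * 2 ^ (k - l) * t = ((2 : ℝ) ^ l * t) * 2 ^ (k - l) by ring]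
    exact (mul_le_mul_iff_left₀ (by positivity)).symm
  show ⌊(2 : ℝ) ^ l * x i⌋ = ⌊(2 : ℝ) ^ l * y i⌋
  refine eq_of_forall_le_iff fun a => ?_
  rw [aux, aux, hi]

lemma dyad_ediam (d : ℕ) : ∃ C : NNReal, ∀ (k : ℕ) (z : Fin d → ℤ),
    ediam {x | dyad d k x = z} ≤ C * (2 : ℝ≥0∞)⁻¹ ^ k := by
  refine ⟨(Fintype.card (Fin d) : NNReal) ^ (1 / (2 : ℝ≥0∞)).toReal,
    fun k z => ediam_le fun x hx y hy => ?_⟩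
  refine (PiLp.antilipschitzWith_ofLp 2 (fun _ : Fin d => ℝ) x y).trans ?_
  gcongr
  refine edist_pi_le_iff.2 fun i => ?_
  have hi : ⌊(2 : ℝ) ^ k * x i⌋ = ⌊(2 : ℝ) ^ k * y i⌋ := (congrFun hx i).trans (congrFun hy i).symm
  have h1 := Int.abs_sub_lt_one_of_floor_eq_floor hi
  have h2 : dist (x i) (y i) ≤ (2⁻¹ : ℝ) ^ k := by
    rw [Real.dist_eq]
    rw [← mul_sub, abs_mul, abs_of_pos (by positivity : (0 : ℝ) < 2 ^ k)] at h1
    rw [inv_pow, ← one_div, le_div_iff₀ (by positivity)]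
    linarith
  show edist (x i) (y i) ≤ _
  rw [edist_dist]
  refine (ENNReal.ofReal_le_ofReal h2).trans (le_of_eq ?_)
  rw [ENNReal.ofReal_pow (by positivity), ENNReal.ofReal_inv_of_pos (by norm_num)]
  simp

lemma hausdorff_zero_of_netM {d n : ℕ} (hn : 0 < n) {E : Set (EuclideanSpace ℝ (Fin d))}
    (hE : netM (dyad d) (dyadW d n) E = 0) : μH[(n : ℝ)] E = 0 := by
  obtain ⟨C, hC⟩ := dyad_ediam d
  have hpos : ∀ k : ℕ, (0 : ℝ≥0∞) < ((2 : ℝ≥0∞)⁻¹ ^ k) ^ n := fun k =>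
    ENNReal.pow_pos (ENNReal.pow_pos (by simp) _) _
  choose S hS1 hS2 using fun k : ℕ => netM_exists (hE.trans_lt (hpos k))
  have hlim : Filter.Tendsto (fun k : ℕ => (2 : ℝ≥0∞)⁻¹ ^ k) Filter.atTop (𝓝 0) :=
    ENNReal.tendsto_pow_atTop_nhds_zero_of_lt_one (by simp)
  have hlimC : Filter.Tendsto (fun k : ℕ => C * (2 : ℝ≥0∞)⁻¹ ^ k) Filter.atTop (𝓝 0) := by
    simpa using ENNReal.Tendsto.const_mul hlim (Or.inr ENNReal.coe_ne_top)
  have hlimn : Filter.Tendsto (fun k : ℕ => (C * (2 : ℝ≥0∞)⁻¹ ^ k) ^ n) Filter.atTop (𝓝 0) := by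
    have := ((ENNReal.continuous_pow n).tendsto 0).comp hlimC
    simpa [Function.comp_def, hn.ne'] using this
  classical
  let t : ℕ → (ℕ × (Fin d → ℤ)) → Set (EuclideanSpace ℝ (Fin d)) := fun k p =>
    if p ∈ S k then {x | dyad d p.1 x = p.2} else ∅
  refine le_antisymm ?_ zero_le
  calc μH[(n : ℝ)] E ≤ Filter.liminf (fun k => ∑' p, ediam (t k p) ^ (n : ℝ)) Filter.atTop := by
        refine Measure.hausdorffMeasure_le_liminf_tsum _ _ _ hlimC t ?_ ?_
        · refine Filter.Eventually.of_forall fun k p => ?_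
          by_cases hp : p ∈ S k
          · simp only [t, hp, if_true]
            refine (hC _ _).trans ?_
            have h1 : ((2 : ℝ≥0∞)⁻¹ ^ p.1) ^ n ≤ ((2 : ℝ≥0∞)⁻¹ ^ k) ^ n := by
              refine le_trans ?_ (hS2 k).le
              rw [dyadW_apply]
              refine le_trans ?_ (ENNReal.le_tsum p)
              simp [hp]
            exact mul_le_mul_right ((ENNReal.pow_le_pow_left_iff hn.ne').1 h1) _
          · simp [t, hp]
        · refine Filter.Eventually.of_forall fun k x hx => ?_
          obtain ⟨l, hl⟩ := hS1 k hx
          refine Set.mem_iUnion.2 ⟨(l, dyad d l x), ?_⟩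
          simp only [t]
          rw [if_pos hl]
          rfl
    _ ≤ Filter.liminf (fun k : ℕ => (C * (2 : ℝ≥0∞)⁻¹ ^ k) ^ n) Filter.atTop := by
        refine Filter.liminf_le_liminf (Filter.Eventually.of_forall fun k => ?_)
        calc ∑' p, ediam (t k p) ^ (n : ℝ) 
            ≤ ∑' p, (C : ℝ≥0∞) ^ n * (S k).indicator (fun p => ((2 : ℝ≥0∞)⁻¹ ^ p.1) ^ n) p := by
              refine ENNReal.tsum_le_tsum fun p => ?_
              rw [ENNReal.rpow_natCast]
              by_cases hp : p ∈ S k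
              · simp only [t, hp, if_true, Set.indicator_of_mem, ← mul_pow]
                exact pow_le_pow_left' (hC _ _) _
              · simp [t, hp, hn.ne']
          _ = (C : ℝ≥0∞) ^ n * dyadW d n (S k) := by rw [ENNReal.tsum_mul_left, dyadW_apply]
          _ ≤ _ := by
              rw [mul_pow]
              gcongr
              exact (hS2 k).le
    _ = 0 := hlimn.liminf_eq

lemma exists_cover_of_ediam_le (d n : ℕ) (A : Set (EuclideanSpace ℝ (Fin d))) {ρ : ℝ≥0∞}
    (hρ : 0 < ρ) (hρ1 : ρ ≤ 1) (hA : ediam A ≤ ρ) :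
    ∃ S, A ⊆ netCov (dyad d) S ∧ dyadW d n S ≤ (3 ^ d * 2 ^ n : ℕ) * ρ ^ n := by
  rcases A.eq_empty_or_nonempty with rfl | ⟨x, hx⟩
  · exact ⟨∅, by simp, by simp⟩
  lift ρ to NNReal using (hρ1.trans_lt ENNReal.one_lt_top).ne
  have h0 : 0 < ρ := by exact_mod_cast hρ
  have h1 : ρ ≤ 1 := by exact_mod_cast hρ1
  obtain ⟨k, hk1, hk2⟩ := exists_nat_pow_near_of_lt_one h0 h1 (y := (2⁻¹ : NNReal)) (by norm_num)
    (by rw [← one_div]; exact NNReal.half_lt_self one_ne_zero)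
  let P : Finset (Fin d → ℤ) := Fintype.piFinset fun i => Finset.Icc (dyad d k x i - 1) (dyad d k x i + 1)
  have hPc : P.card = 3 ^ d := by
    simp only [P, Fintype.card_piFinset, Int.card_Icc]
    have : ∀ a : ℤ, (a + 1 + 1 - (a - 1)).toNat = 3 := fun a => by omega
    simp [this]
  let S : Finset (ℕ × (Fin d → ℤ)) := P.map ⟨fun z => (k, z), fun a b h => (Prod.mk.inj h).2⟩
  refine ⟨S, ?_, ?_⟩
  · intro y hy
    refine ⟨k, ?_⟩
    have : dyad d k y ∈ P := by
      rw [Fintype.mem_piFinset]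
      intro i
      have hd : dist (x i) (y i) ≤ (2⁻¹ : ℝ) ^ k := by
        have e1 : edist (x i) (y i) ≤ edist x y := by
          have := (PiLp.lipschitzWith_ofLp 2 (fun _ : Fin d => ℝ)) x y
          rw [ENNReal.coe_one, one_mul] at this
          exact (edist_le_pi_edist _ _ i).trans this
        have e2 : edist (x i) (y i) ≤ ρ := e1.trans ((edist_le_ediam_of_mem hx hy).trans hA)
        have e3 : dist (x i) (y i) ≤ ρ := by
          rw [edist_nndist] at e2
          exact_mod_cast e2
        exact e3.trans (by exact_mod_cast hk2)
      rw [Real.dist_eq, inv_pow, ← one_div, le_div_iff₀ (by positivity)] at hd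
      have hd' : |(2 : ℝ) ^ k * x i - 2 ^ k * y i| ≤ 1 := by
        rw [← mul_sub, abs_mul, abs_of_pos (by positivity : (0 : ℝ) < 2 ^ k)]
        linarith
      rw [abs_le] at hd'
      rw [Finset.mem_Icc]
      constructor
      · show ⌊(2 : ℝ) ^ k * x i⌋ - 1 ≤ ⌊(2 : ℝ) ^ k * y i⌋
        rw [Int.le_floor]
        push_cast
        have := Int.floor_le ((2 : ℝ) ^ k * x i)
        linarith
      · show ⌊(2 : ℝ) ^ k * y i⌋ ≤ ⌊(2 : ℝ) ^ k * x i⌋ + 1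
        rw [← Int.floor_add_one]
        apply Int.floor_le_floor
        linarith
    exact Finset.mem_coe.2 (Finset.mem_map.2 ⟨_, this, rfl⟩)
  · have hW : dyadW d n S = (3 ^ d : ℕ) * ((2 : ℝ≥0∞)⁻¹ ^ k) ^ n := by
      rw [dyadW_apply, ← tsum_subtype, Finset.tsum_subtype' S (fun p => ((2 : ℝ≥0∞)⁻¹ ^ p.1) ^ n)]
      rw [Finset.sum_map]
      show ∑ x ∈ P, ((2 : ℝ≥0∞)⁻¹ ^ k) ^ n = _
      rw [Finset.sum_const, hPc, nsmul_eq_mul]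
    rw [hW]
    have hle : (2 : ℝ≥0∞)⁻¹ ^ k ≤ 2 * ρ := by
      have h3 : (2⁻¹ : NNReal) ^ k ≤ 2 * ρ := by
        rw [pow_succ] at hk1
        calc (2⁻¹ : NNReal) ^ k = 2 * (2⁻¹ ^ k * 2⁻¹) := by field_simp
          _ ≤ 2 * ρ := by gcongr
      have h4 : (((2⁻¹ : NNReal) ^ k : NNReal) : ℝ≥0∞) ≤ ((2 * ρ : NNReal) : ℝ≥0∞) := by exact_mod_cast h3
      rw [ENNReal.coe_pow, ENNReal.coe_inv (by norm_num)] at h4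
      simpa using h4
    calc ((3 ^ d : ℕ) : ℝ≥0∞) * ((2 : ℝ≥0∞)⁻¹ ^ k) ^ n ≤ (3 ^ d : ℕ) * (2 * ρ) ^ n := by gcongr
      _ = _ := by push_cast; rw [mul_pow]; ring

lemma exists_open_netM_small {d n : ℕ} (hn : 0 < n) {E : Set (EuclideanSpace ℝ (Fin d))}
    (hE : μH[(n : ℝ)] E = 0) {ε : ℝ≥0∞} (hε : 0 < ε) (hε' : ε ≠ ∞) :
    ∃ V, IsOpen V ∧ E ⊆ V ∧ netM (dyad d) (dyadW d n) V ≤ (3 ^ d * 2 ^ n : ℕ) * ε := by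
  obtain ⟨V, ρ, h1, h2, h3, h4, h5, h6⟩ := mkMetric_open_cover
    (m := fun r => r ^ (n : ℝ)) (fun t _ => ENNReal.continuous_rpow_const.continuousWithinAt)
    (by simp [hn.ne']) hE one_pos ENNReal.one_ne_top hε hε'
  refine ⟨⋃ j, V j, isOpen_iUnion h1, h2, ?_⟩
  choose S hS1 hS2 using fun j => exists_cover_of_ediam_le d n (V j) (h4 j) (h5 j) (h3 j)
  refine (netM_le (S := ⋃ j, S j) ?_).trans ?_
  · refine Set.iUnion_subset fun j x hx => ?_
    obtain ⟨k, hk⟩ := hS1 j hx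
    exact ⟨k, Set.mem_iUnion.2 ⟨j, hk⟩⟩
  · refine (measure_iUnion_le _).trans ((ENNReal.tsum_le_tsum hS2).trans ?_)
    rw [ENNReal.tsum_mul_left]
    gcongr
    simpa using h6

theorem stmt_16 (n d : ℕ) (hn : 2 ≤ n)
    (Ω : Set (EuclideanSpace ℝ (Fin n))) (hΩ : IsOpen Ω)
    (f : EuclideanSpace ℝ (Fin n) → EuclideanSpace ℝ (Fin d)) (hf : ContinuousOn f Ω)
    (φ : ℝ → ℝ) (hφ : IsGauge φ)
    (N : Set (EuclideanSpace ℝ (Fin n))) (hNΩ : N ⊆ Ω)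
    (hNφ : hausdorffGauge φ N = 0)
    (hfN : 0 < μH[(n : ℝ)] (f '' N)) :
    ∃ K : Set (EuclideanSpace ℝ (Fin n)), K ⊆ Ω ∧ IsCompact K ∧ Perfect K ∧
      IsTotallyDisconnected K ∧ hausdorffGauge φ K = 0 ∧ 0 < μH[(n : ℝ)] (f '' K) := by
  have hn0 : 0 < n := by omega
  obtain ⟨hφm, -, hφc⟩ := hφ
  set m : ℝ≥0∞ → ℝ≥0∞ := fun d => ENNReal.ofReal (φ d.toReal) with hmdef
  have hmono : ∀ s t, t ≠ ∞ → s ≤ t → m s ≤ m t := fun s t ht hst =>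
    ENNReal.ofReal_le_ofReal (hφm (ENNReal.toReal_mono ht hst))
  have hm : ∀ t, t ≠ ∞ → ContinuousWithinAt m (Set.Ici t) t := by
    intro t ht
    refine ENNReal.continuous_ofReal.continuousAt.comp_continuousWithinAt ?_
    have h1 : Filter.Tendsto ENNReal.toReal (𝓝[≥] t) (𝓝[≥] t.toReal) := by
      refine tendsto_nhdsWithin_iff.2 ⟨(ENNReal.tendsto_toReal ht).mono_left nhdsWithin_le_nhds, ?_⟩
      have h2 : ∀ᶠ s in 𝓝[≥] t, s ≠ ∞ :=
        nhdsWithin_le_nhds (isOpen_ne.mem_nhds ht)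
      filter_upwards [h2, self_mem_nhdsWithin] with s hs hts
      exact ENNReal.toReal_mono hs hts
    exact (hφc t.toReal ENNReal.toReal_nonneg).tendsto.comp h1
  have hNne : N.Nonempty := by
    rw [Set.nonempty_iff_ne_empty]
    rintro rfl
    simp at hfN
  have hm0 : m 0 = 0 := mkMetric_gauge_zero (fun t ht => hmono 0 t ht zero_le) hNφ hNne
  obtain ⟨α, hα⟩ : ∃ α, μH[(n : ℝ)] (f '' (N \ badSet n α)) ≠ 0 := by
    by_contra! h
    refine hfN.ne' (measure_mono_null ?_ (measure_iUnion_null h))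
    rintro _ ⟨x, hx, rfl⟩
    obtain ⟨α, hα⟩ := exists_not_badSet x
    exact Set.mem_iUnion.2 ⟨α, x, ⟨hx, hα⟩, rfl⟩
  obtain ⟨U, hUo, hUN, hU0⟩ := mkMetric_Gdelta hm hm0 hmono
    (measure_mono_null (Set.sdiff_subset (s := N) (t := badSet n α)) hNφ)
  obtain ⟨O, hOo, hO⟩ := badSet_compl (n := n) (α := α)
  have hcap0 : 0 < netM (dyad d) (dyadW d n) (f '' (N \ badSet n α)) :=
    pos_iff_ne_zero.2 fun h => hα (hausdorff_zero_of_netM hn0 h)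
  obtain ⟨c, hc0, hc⟩ := exists_between hcap0
  have hctop : c ≠ ∞ := (hc.trans_le le_top).ne
  obtain ⟨K, hKc, hKa, hKU, hKcap⟩ := exists_compact_of_capacity
    (U := fun k => U k ∩ O k ∩ Ω) (fun k => ((hUo k).inter (hOo k)).inter hΩ)
    (N := N \ badSet n α)
    (fun k x hx => ⟨⟨hUN k hx, Set.mem_iInter.1 (hO ▸ hx.2 : x ∈ ⋂ k, O k) k⟩, hNΩ hx.1⟩)
    (fun A => netM (dyad d) (dyadW d n) (f '' A)) (c := c)
    (fun A B hAB => netM_mono (Set.image_mono hAB))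
    (by
      intro E hE hcE
      by_contra! h
      refine absurd hcE (not_lt.2 ?_)
      rw [Set.image_iUnion]
      exact netM_iUnion_le (dyad_refine d) (fun a b hab => Set.image_mono (hE hab)) hctop h) hc
  have hKΩ : (⋂ k, K k) ⊆ Ω := fun x hx => (hKU 0 (Set.mem_iInter.1 hx 0)).2
  have hK0 : hausdorffGauge φ (⋂ k, K k) = 0 :=
    measure_mono_null (Set.iInter_mono fun k x hx => (hKU k hx).1.1) hU0
  have hKbad : ∀ x ∈ ⋂ k, K k, x ∉ badSet n α := by
    intro x hx
    have : x ∈ ⋂ k, O k := Set.mem_iInter.2 fun k => (hKU k (Set.mem_iInter.1 hx k)).1.2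
    rwa [← hO] at this
  have hKcomp : IsCompact (⋂ k, K k) :=
    (hKc 0).of_isClosed_subset (isClosed_iInter fun k => (hKc k).isClosed) (Set.iInter_subset _ 0)
  have hKpos : μH[(n : ℝ)] (f '' ⋂ k, K k) ≠ 0 := by
    intro h
    have hC0 : ((3 ^ d * 2 ^ n : ℕ) : ℝ≥0∞) ≠ 0 := by
      rw [Nat.cast_ne_zero]; positivity
    have hCt : ((3 ^ d * 2 ^ n : ℕ) : ℝ≥0∞) ≠ ∞ := ENNReal.natCast_ne_top _
    obtain ⟨V, hVo, hV, hVc⟩ := exists_open_netM_small hn0 h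
      (ENNReal.div_pos hc0.ne' hCt) (ENNReal.div_ne_top hctop hC0)
    rw [ENNReal.mul_div_cancel hC0 hCt] at hVc
    obtain ⟨k, hk⟩ := exists_subset_nhds_of_isCompact (U := f ⁻¹' V)
      (directed_of_isDirected_le fun a b hab => hKa hab) hKc (by
        intro x hx
        exact (hf.continuousAt (hΩ.mem_nhds (hKΩ hx))).preimage_mem_nhds
          (hVo.mem_nhds (hV ⟨x, hx, rfl⟩)))
    exact absurd (hKcap k) (not_lt.2 ((netM_mono (Set.image_subset_iff.2 hk)).trans hVc))
  obtain ⟨Z, D, hZ, hD, hZD⟩ := exists_countable_union_perfect_of_isClosed hKcomp.isClosed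
  have hDK : D ⊆ ⋂ k, K k := hZD ▸ Set.subset_union_right
  refine ⟨D, hDK.trans hKΩ, hKcomp.of_isClosed_subset hD.closed hDK, hD,
    isTotallyDisconnected_of_badSet fun x hx => hKbad x (hDK hx), measure_mono_null hDK hK0, ?_⟩
  refine pos_iff_ne_zero.2 fun h => hKpos ?_
  rw [hZD, Set.image_union]
  have := Measure.nullSingletonClass_hausdorff (EuclideanSpace ℝ (Fin d)) (d := (n : ℝ))
    (by exact_mod_cast hn0)
  exact measure_union_null ((hZ.image f).measure_zero _) h
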